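/- Let p be a prime, let A be a finite abelian p-group, and let A₁, …, A_r be proper subgroups of A. For j = 1, …, r write e_j = log_p [A : A_j] (so each e_j ≥ 1). Then there exists an element γ ∈ A such that Σ_{j : γ ∈ A_j} e_j ≤ ⌊r/p⌋. -/

import Mathlib

/-- A proper subgroup `H` of a finite `p`-group satisfies `p * |H| * log_p [G : H] ≤ |G|`. -/
theorem IsPGroup.mul_card_mul_log_index_le {p : ℕ} (hp : p.Prime) {G : Type*} [Group G]
    [Finite G] (hG : IsPGroup p G) {H : Subgroup G} (hH : H ≠ ⊤) :
    p * (Nat.card H * Nat.log p H.index) ≤ Nat.card G := by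
  have : Fact p.Prime := ⟨hp⟩
  obtain ⟨n, hn⟩ := hG.index H
  obtain _ | m := n
  · exact absurd (Subgroup.index_eq_one.mp (by simpa using hn)) hH
  · rw [hn, Nat.log_pow hp.one_lt, ← H.card_mul_index, hn, pow_succ]
    have hm : m + 1 ≤ p ^ m := Nat.lt_pow_self hp.one_lt
    calc p * (Nat.card H * (m + 1)) ≤ p * (Nat.card H * p ^ m) := by gcongr
      _ = Nat.card H * (p ^ m * p) := by ring

open scoped Classical in
/-- **The averaging argument in Lemma 5.2 (Mundet i Riera).**
Let `p` be a prime, `A` a finite abelian `p`-group and `A₁, …, A_r` proper subgroups of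
`A`; write `e_j = log_p [A : A_j] ≥ 1`.  Then some `γ ∈ A` satisfies
`∑_{j : γ ∈ A_j} e_j ≤ ⌊r/p⌋`. -/
theorem exists_element_avoiding_proper_subgroups
    (p : ℕ) (hp : p.Prime) (A : Type) [CommGroup A] [Finite A] (hA : IsPGroup p A)
    (r : ℕ) (B : Fin r → Subgroup A) (hB : ∀ j, B j ≠ ⊤) :
    ∃ γ : A, (∑ j : Fin r, if γ ∈ B j then Nat.log p (B j).index else 0) ≤ r / p := by
  have := Fintype.ofFinite A
  by_contra! h
  have hlower : Nat.card A * (r / p + 1) ≤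
      ∑ γ : A, ∑ j : Fin r, if γ ∈ B j then Nat.log p (B j).index else 0 := by
    simpa [Nat.card_eq_fintype_card] using
      Finset.card_nsmul_le_sum Finset.univ _ (r / p + 1) fun γ _ => h γ
  have hcount (j : Fin r) : (∑ γ : A, if γ ∈ B j then Nat.log p (B j).index else 0) =
      Nat.card (B j) * Nat.log p (B j).index := by
    rw [← Finset.sum_filter, Finset.sum_const, smul_eq_mul, Nat.card_eq_fintype_card,
      Fintype.card_subtype]
  rw [Finset.sum_comm, Finset.sum_congr rfl fun j _ => hcount j] at hlower
  have hupper : p * ∑ j : Fin r, Nat.card (B j) * Nat.log p (B j).index ≤ r * Nat.card A := by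
    rw [Finset.mul_sum]
    simpa using Finset.sum_le_card_nsmul Finset.univ _ (Nat.card A)
      fun j _ => hA.mul_card_mul_log_index_le hp (hB j)
  have hle : Nat.card A * (p * (r / p + 1)) ≤ Nat.card A * r := by
    calc Nat.card A * (p * (r / p + 1)) = p * (Nat.card A * (r / p + 1)) := by ring
      _ ≤ r * Nat.card A := (Nat.mul_le_mul_left p hlower).trans hupper
      _ = Nat.card A * r := mul_comm _ _
  exact (Nat.lt_mul_div_succ r hp.pos).not_ge (Nat.le_of_mul_le_mul_left hle Nat.card_pos)
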